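/- Let R ⊆ (β̄×β)^− be a negative twisted chain and S ⊆ (β̄×β)^+ a positive twisted chain. Let 𝓜_R be the set of star sets U ⊆ (β̄×β)^− with R ⊴ U which have maximal cardinality among all such star sets; let 𝓜^S be the set of star sets V ⊆ (β̄×β)^+ with V ⊴ S which have maximal cardinality among all such star sets; and let 𝓜_R^S be the set of star sets W ⊆ β̄×β with R ⊴ W^− and W^+ ⊴ S which have maximal cardinality among all such star sets. Then 𝓜_R^S = { U ∪ V : U ∈ 𝓜_R, V ∈ 𝓜^S } (and each such union is disjoint). -/

import Mathlib

/-- `starOf d j = j* = 2d+1-j`. -/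
def starOf (d j : ℕ) : ℕ := 2 * d + 1 - j

/-- `(e,f)` is a negative element of `ℕ²` (pairs of positive integers): `0 < e < f`. -/
def NegPair (p : ℕ × ℕ) : Prop := 0 < p.1 ∧ p.1 < p.2

/-- `(e,f) ≺ (g,h)` iff `f < h` and `e > g`. -/
def Prec (p q : ℕ × ℕ) : Prop := p.2 < q.2 ∧ q.1 < p.1

/-- `(e,f) ⊴ (g,h)` iff `f ≤ h` and `e ≥ g`. -/
def TriLe (p q : ℕ × ℕ) : Prop := p.2 ≤ q.2 ∧ q.1 ≤ p.1

/-- `(c,d) ∧ (e,f) := (max(c,e), min(d,f))`. -/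
def Wedge (p q : ℕ × ℕ) : ℕ × ℕ := (max p.1 q.1, min p.2 q.2)

/-- `T` is completely disjointed: all the coordinates of all its elements are
pairwise distinct. -/
def CompletelyDisjointed (T : Finset (ℕ × ℕ)) : Prop :=
  (∀ p ∈ T, p.1 ≠ p.2) ∧
  ∀ p ∈ T, ∀ q ∈ T, p ≠ q →
    p.1 ≠ q.1 ∧ p.1 ≠ q.2 ∧ p.2 ≠ q.1 ∧ p.2 ≠ q.2

/-- A negative twisted chain. -/
def NegTwistedChain (T : Finset (ℕ × ℕ)) : Prop :=
  (∀ p ∈ T, NegPair p) ∧ CompletelyDisjointed T ∧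
  ∀ p ∈ T, ∀ q ∈ T, p ≠ q → Prec p q ∨ Prec q p ∨ ¬ NegPair (Wedge p q)

/-- `ι` applied elementwise: `ι(e,f) = (f,e)`. -/
def iotaSet (T : Finset (ℕ × ℕ)) : Finset (ℕ × ℕ) := T.image Prod.swap

/-- A positive twisted chain: a set of positive elements whose image under `ι`
is a negative twisted chain. -/
def PosTwistedChain (T : Finset (ℕ × ℕ)) : Prop :=
  (∀ p ∈ T, 0 < p.2 ∧ p.2 < p.1) ∧ NegTwistedChain (iotaSet T)

/-- `depth_A(x)`: the maximum `r` such that there is a chain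
`u_1 ≺ u_2 ≺ … ≺ u_r` in `A` with `u_r ⊴ x` (and `0` if there is none). -/
noncomputable def depth (A : Finset (ℕ × ℕ)) (x : ℕ × ℕ) : ℕ :=
  sSup {r : ℕ | ∃ u : Fin r → ℕ × ℕ, (∀ i, u i ∈ A) ∧
    (∀ i j : Fin r, i < j → Prec (u i) (u j)) ∧
    ∀ i : Fin r, (i : ℕ) = r - 1 → TriLe (u i) x}

/-- `A ⊴ B` for negative subsets `A, B` of `ℕ²`:
`depth_A(x) ≥ depth_B(x)` for every negative `x`. -/
def NegSubsetTriLe (A B : Finset (ℕ × ℕ)) : Prop :=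
  ∀ x : ℕ × ℕ, NegPair x → depth B x ≤ depth A x

/-- `A ⊴ B` for positive subsets `A, B` of `ℕ²`: `ι(B) ⊴ ι(A)`. -/
def PosSubsetTriLe (A B : Finset (ℕ × ℕ)) : Prop :=
  NegSubsetTriLe (iotaSet B) (iotaSet A)

/-- A star set: whenever `(r,c) ∈ U` and `r ≠ c*`, also `(c*, r*) ∈ U`. -/
def StarClosed (d : ℕ) (U : Finset (ℕ × ℕ)) : Prop :=
  ∀ p ∈ U, p.1 ≠ starOf d p.2 → (starOf d p.2, starOf d p.1) ∈ U

/-- `𝓜_R`: the star sets `U ⊆ (β̄ × β)⁻` with `R ⊴ U` of maximal cardinality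
among all such star sets. -/
def MR (d : ℕ) (β : Finset ℕ) (R : Finset (ℕ × ℕ)) : Set (Finset (ℕ × ℕ)) :=
  {U | (U ⊆ ((Finset.Icc 1 (2 * d) \ β) ×ˢ β).filter (fun p => p.1 < p.2) ∧
          StarClosed d U ∧ NegSubsetTriLe R U) ∧
       ∀ U' : Finset (ℕ × ℕ),
         (U' ⊆ ((Finset.Icc 1 (2 * d) \ β) ×ˢ β).filter (fun p => p.1 < p.2) ∧
           StarClosed d U' ∧ NegSubsetTriLe R U') → U'.card ≤ U.card}

/-- `𝓜^S`: the star sets `V ⊆ (β̄ × β)⁺` with `V ⊴ S` of maximal cardinality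
among all such star sets. -/
def MS (d : ℕ) (β : Finset ℕ) (S : Finset (ℕ × ℕ)) : Set (Finset (ℕ × ℕ)) :=
  {V | (V ⊆ ((Finset.Icc 1 (2 * d) \ β) ×ˢ β).filter (fun p => p.2 < p.1) ∧
          StarClosed d V ∧ PosSubsetTriLe V S) ∧
       ∀ V' : Finset (ℕ × ℕ),
         (V' ⊆ ((Finset.Icc 1 (2 * d) \ β) ×ˢ β).filter (fun p => p.2 < p.1) ∧
           StarClosed d V' ∧ PosSubsetTriLe V' S) → V'.card ≤ V.card}

/-- `𝓜_R^S`: the star sets `W ⊆ β̄ × β` with `R ⊴ W⁻` and `W⁺ ⊴ S` of maximal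
cardinality among all such star sets. -/
def MRS (d : ℕ) (β : Finset ℕ) (R S : Finset (ℕ × ℕ)) : Set (Finset (ℕ × ℕ)) :=
  {W | (W ⊆ (Finset.Icc 1 (2 * d) \ β) ×ˢ β ∧ StarClosed d W ∧
          NegSubsetTriLe R (W.filter (fun p => p.1 < p.2)) ∧
          PosSubsetTriLe (W.filter (fun p => p.2 < p.1)) S) ∧
       ∀ W' : Finset (ℕ × ℕ),
         (W' ⊆ (Finset.Icc 1 (2 * d) \ β) ×ˢ β ∧ StarClosed d W' ∧
           NegSubsetTriLe R (W'.filter (fun p => p.1 < p.2)) ∧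
           PosSubsetTriLe (W'.filter (fun p => p.2 < p.1)) S) → W'.card ≤ W.card}

theorem StarClosed.union {d : ℕ} {U V : Finset (ℕ × ℕ)} (hU : StarClosed d U)
    (hV : StarClosed d V) : StarClosed d (U ∪ V) := by
  intro p hp hne
  rcases Finset.mem_union.1 hp with h | h
  · exact Finset.mem_union_left _ (hU p h hne)
  · exact Finset.mem_union_right _ (hV p h hne)

/-- The map `(r,c) ↦ (c*,r*)` preserves negativity, so the negative part of a star set is a
star set. -/
theorem StarClosed.filter_neg {d : ℕ} {W : Finset (ℕ × ℕ)} (hW : StarClosed d W)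
    (hle : ∀ p ∈ W, p.1 ≤ 2 * d) : StarClosed d (W.filter fun p => p.1 < p.2) := by
  intro p hp hne
  rw [Finset.mem_filter] at hp ⊢
  refine ⟨hW p hp.1 hne, ?_⟩
  have := hle p hp.1
  simp only [starOf]
  omega

/-- The map `(r,c) ↦ (c*,r*)` preserves positivity, so the positive part of a star set is a
star set. -/
theorem StarClosed.filter_pos {d : ℕ} {W : Finset (ℕ × ℕ)} (hW : StarClosed d W)
    (hle : ∀ p ∈ W, p.2 ≤ 2 * d) : StarClosed d (W.filter fun p => p.2 < p.1) := by
  intro p hp hne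
  rw [Finset.mem_filter] at hp ⊢
  refine ⟨hW p hp.1 hne, ?_⟩
  have := hle p hp.1
  simp only [starOf]
  omega

section SignParts

variable {A U V W : Finset (ℕ × ℕ)}

theorem disjoint_of_subset_neg_of_subset_pos (hU : U ⊆ A.filter fun p => p.1 < p.2)
    (hV : V ⊆ A.filter fun p => p.2 < p.1) : Disjoint U V := by
  rw [Finset.disjoint_left]
  intro p hpU hpV
  have h₁ := (Finset.mem_filter.1 (hU hpU)).2
  have h₂ := (Finset.mem_filter.1 (hV hpV)).2
  omega

theorem filter_neg_union (hU : U ⊆ A.filter fun p => p.1 < p.2)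
    (hV : V ⊆ A.filter fun p => p.2 < p.1) : (U ∪ V).filter (fun p => p.1 < p.2) = U := by
  ext p
  have h₁ : p ∈ U → p.1 < p.2 := fun h => (Finset.mem_filter.1 (hU h)).2
  have h₂ : p ∈ V → p.2 < p.1 := fun h => (Finset.mem_filter.1 (hV h)).2
  simp only [Finset.mem_filter, Finset.mem_union]
  grind

theorem filter_pos_union (hU : U ⊆ A.filter fun p => p.1 < p.2)
    (hV : V ⊆ A.filter fun p => p.2 < p.1) : (U ∪ V).filter (fun p => p.2 < p.1) = V := by
  ext p
  have h₁ : p ∈ U → p.1 < p.2 := fun h => (Finset.mem_filter.1 (hU h)).2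
  have h₂ : p ∈ V → p.2 < p.1 := fun h => (Finset.mem_filter.1 (hV h)).2
  simp only [Finset.mem_filter, Finset.mem_union]
  grind

theorem filter_neg_union_filter_pos (hW : ∀ p ∈ W, p.1 ≠ p.2) :
    W.filter (fun p => p.1 < p.2) ∪ W.filter (fun p => p.2 < p.1) = W := by
  ext p
  have h : p ∈ W → p.1 ≠ p.2 := hW p
  simp only [Finset.mem_filter, Finset.mem_union]
  grind

end SignParts

/-- `𝓜_R^S = { U ∪ V : U ∈ 𝓜_R, V ∈ 𝓜^S }`, and each such union is disjoint. -/
theorem MRS_eq_union_MR_MS (d : ℕ) (hd : 0 < d) (β : Finset ℕ)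
    (hβsub : β ⊆ Finset.Icc 1 (2 * d))
    (hβ : ∀ j ∈ Finset.Icc 1 (2 * d), j ∈ β ↔ starOf d j ∉ β)
    (R S : Finset (ℕ × ℕ))
    (hR : R ⊆ ((Finset.Icc 1 (2 * d) \ β) ×ˢ β).filter (fun p => p.1 < p.2))
    (hRtc : NegTwistedChain R)
    (hS : S ⊆ ((Finset.Icc 1 (2 * d) \ β) ×ˢ β).filter (fun p => p.2 < p.1))
    (hStc : PosTwistedChain S) :
    MRS d β R S = {W | ∃ U ∈ MR d β R, ∃ V ∈ MS d β S, W = U ∪ V} ∧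
    ∀ U ∈ MR d β R, ∀ V ∈ MS d β S, Disjoint U V := by
  set A := (Finset.Icc 1 (2 * d) \ β) ×ˢ β
  have hmemA : ∀ p ∈ A, p.1 ≤ 2 * d ∧ p.2 ≤ 2 * d ∧ p.1 ≠ p.2 := by
    intro p hp
    obtain ⟨h₁, h₂⟩ := Finset.mem_product.1 hp
    obtain ⟨h₃, h₄⟩ := Finset.mem_sdiff.1 h₁
    exact ⟨(Finset.mem_Icc.1 h₃).2, (Finset.mem_Icc.1 (hβsub h₂)).2,
      fun h => h₄ (h ▸ h₂)⟩
  have hsplit : ∀ W ⊆ A,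
      (W.filter fun p => p.1 < p.2) ∪ (W.filter fun p => p.2 < p.1) = W :=
    fun W hW => filter_neg_union_filter_pos fun p hp => (hmemA p (hW hp)).2.2
  have hneg : ∀ W ⊆ A, StarClosed d W → StarClosed d (W.filter fun p => p.1 < p.2) :=
    fun W hW hs => hs.filter_neg fun p hp => (hmemA p (hW hp)).1
  have hpos : ∀ W ⊆ A, StarClosed d W → StarClosed d (W.filter fun p => p.2 < p.1) :=
    fun W hW hs => hs.filter_pos fun p hp => (hmemA p (hW hp)).2.1
  have hcard : ∀ U V : Finset (ℕ × ℕ), (U ⊆ A.filter fun p => p.1 < p.2) →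
      (V ⊆ A.filter fun p => p.2 < p.1) → (U ∪ V).card = U.card + V.card :=
    fun U V hU hV =>
      Finset.card_union_of_disjoint (disjoint_of_subset_neg_of_subset_pos hU hV)
  have hunion : ∀ U V : Finset (ℕ × ℕ),
      ((U ⊆ A.filter fun p => p.1 < p.2) ∧ StarClosed d U ∧ NegSubsetTriLe R U) →
      ((V ⊆ A.filter fun p => p.2 < p.1) ∧ StarClosed d V ∧ PosSubsetTriLe V S) →
      U ∪ V ⊆ A ∧ StarClosed d (U ∪ V) ∧
        NegSubsetTriLe R ((U ∪ V).filter fun p => p.1 < p.2) ∧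
        PosSubsetTriLe ((U ∪ V).filter fun p => p.2 < p.1) S := by
    rintro U V ⟨hU, hsU, hRU⟩ ⟨hV, hsV, hVS⟩
    rw [filter_neg_union hU hV, filter_pos_union hU hV]
    exact ⟨Finset.union_subset (hU.trans (Finset.filter_subset _ _))
      (hV.trans (Finset.filter_subset _ _)), hsU.union hsV, hRU, hVS⟩
  refine ⟨Set.ext fun W => ⟨?_, ?_⟩,
    fun U hU V hV => disjoint_of_subset_neg_of_subset_pos hU.1.1 hV.1.1⟩
  · rintro ⟨⟨hWA, hs, hRW, hWS⟩, hmax⟩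
    have hn := Finset.filter_subset_filter (fun p : ℕ × ℕ => p.1 < p.2) hWA
    have hp := Finset.filter_subset_filter (fun p : ℕ × ℕ => p.2 < p.1) hWA
    have hWcard := hcard _ _ hn hp
    rw [hsplit W hWA] at hWcard
    refine ⟨W.filter fun p => p.1 < p.2, ⟨⟨hn, hneg W hWA hs, hRW⟩, fun U' hU' => ?_⟩,
      W.filter fun p => p.2 < p.1, ⟨⟨hp, hpos W hWA hs, hWS⟩, fun V' hV' => ?_⟩,
      (hsplit W hWA).symm⟩
    · have h := hmax _ (hunion U' _ hU' ⟨hp, hpos W hWA hs, hWS⟩)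
      rw [hcard _ _ hU'.1 hp] at h
      omega
    · have h := hmax _ (hunion _ V' ⟨hn, hneg W hWA hs, hRW⟩ hV')
      rw [hcard _ _ hn hV'.1] at h
      omega
  · rintro ⟨U, hU, V, hV, rfl⟩
    refine ⟨hunion U V hU.1 hV.1, ?_⟩
    rintro W' ⟨hWA, hs, hRW, hWS⟩
    have hn := Finset.filter_subset_filter (fun p : ℕ × ℕ => p.1 < p.2) hWA
    have hp := Finset.filter_subset_filter (fun p : ℕ × ℕ => p.2 < p.1) hWA
    rw [← hsplit W' hWA, hcard _ _ hn hp, hcard _ _ hU.1.1 hV.1.1]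
    exact Nat.add_le_add (hU.2 _ ⟨hn, hneg W' hWA hs, hRW⟩)
      (hV.2 _ ⟨hp, hpos W' hWA hs, hWS⟩)
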